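/- arXiv:2310.00090 — 9 statements merged into one kernel-verified Lean document; each statement's English description precedes it below -/
import Mathlib

section
/- Let r ≥ 1 and let 𝔽 = 𝔽_{2^r}. The 4×4 Hadamard matrix Had(a,b,c,d) over 𝔽 is MDS if and only if: (i) a, b, c, d are all nonzero; (ii) a, b, c, d are pairwise distinct; (iii) a·d ≠ b·c; (iv) b·d ≠ a·c; (v) c·d ≠ a·b; and (vi) a + b + c + d ≠ 0. -/
open Matrix

/-- A square matrix is MDS if every square submatrix (selected via injective
row and column index maps) is nonsingular. -/
def IsMDS {F : Type*} [Field F] {ι : Type*} (M : Matrix ι ι F) : Prop :=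
  ∀ (k : ℕ) (row : Fin k → ι) (col : Fin k → ι),
    Function.Injective row → Function.Injective col →
    (M.submatrix row col).det ≠ 0

/-- The `4 × 4` finite-field Hadamard matrix with first row `a, b, c, d`. -/
def Had {F : Type*} (a b c d : F) : Matrix (Fin 4) (Fin 4) F :=
  !![a, b, c, d; b, a, d, c; c, d, a, b; d, c, b, a]

theorem exists_eq_succAbove_comp_perm {n : ℕ} {f : Fin n → Fin (n + 1)}
    (hf : Function.Injective f) :
    ∃ (p : Fin (n + 1)) (e : Equiv.Perm (Fin n)), f = p.succAbove ∘ e := by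
  have hsurj : ¬ Function.Surjective f := fun h => by
    simpa using Fintype.card_le_of_surjective f h
  obtain ⟨p, hp⟩ := not_forall.1 hsurj
  choose g hg using fun i => Fin.exists_succAbove_eq fun h : f i = p => hp ⟨i, h⟩
  have hinj : Function.Injective g := fun i j hij => hf (by rw [← hg i, ← hg j, hij])
  exact ⟨p, Equiv.ofBijective g (Finite.injective_iff_bijective.1 hinj),
    funext fun i => (hg i).symm⟩

theorem det_submatrix_perm_ne_zero {F n : Type*} [Field F] [Fintype n] [DecidableEq n]
    {M : Matrix n n F} (hM : M.det ≠ 0) (σ τ : Equiv.Perm n) :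
    (M.submatrix σ τ).det ≠ 0 := by
  have h : M.submatrix σ τ = (M.submatrix σ id).submatrix id τ := rfl
  rw [h, det_permute', det_permute]
  rcases Int.units_eq_one_or (Equiv.Perm.sign σ) with h₁ | h₁ <;>
    rcases Int.units_eq_one_or (Equiv.Perm.sign τ) with h₂ | h₂ <;> simp [h₁, h₂, hM]

theorem IsMDS.apply_ne_zero {F ι : Type*} [Field F] {M : Matrix ι ι F} (hM : IsMDS M)
    (i j : ι) : M i j ≠ 0 := by
  simpa using hM 1 (fun _ => i) (fun _ => j) (Function.injective_of_subsingleton _)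
    (Function.injective_of_subsingleton _)

theorem IsMDS.mul_apply_ne {F ι : Type*} [Field F] {M : Matrix ι ι F} (hM : IsMDS M)
    {i j k l : ι} (hij : i ≠ j) (hkl : k ≠ l) : M i k * M j l ≠ M i l * M j k := by
  have h := hM 2 ![i, j] ![k, l] (by simpa [Function.Injective, Fin.forall_fin_two] using
    ⟨hij, hij.symm⟩) (by simpa [Function.Injective, Fin.forall_fin_two] using ⟨hkl, hkl.symm⟩)
  rw [det_fin_two, sub_ne_zero] at h
  exact h

theorem had_mul_self {F : Type*} [Field F] [CharP F 2] (a b c d : F) :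
    Had a b c d * Had a b c d = (a + b + c + d) ^ 2 • (1 : Matrix (Fin 4) (Fin 4) F) := by
  have h2 : (2 : F) = 0 := CharTwo.two_eq_zero
  ext i j
  fin_cases i <;> fin_cases j <;>
    simp [Had, mul_apply, Fin.sum_univ_four] <;> grind

theorem det_had_ne_zero_iff {F : Type*} [Field F] [CharP F 2] (a b c d : F) :
    (Had a b c d).det ≠ 0 ↔ a + b + c + d ≠ 0 := by
  have h := congrArg det (had_mul_self a b c d)
  rw [det_mul, det_smul, det_one, mul_one, Fintype.card_fin] at h
  refine not_congr ⟨fun h₀ => ?_, fun h₀ => ?_⟩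
  · simpa [h₀] using h.symm
  · simpa [h₀] using h

theorem det_had_submatrix_succAbove_ne_zero {F : Type*} [Field F] [CharP F 2] {a b c d : F}
    (hs : a + b + c + d ≠ 0) (hentry : ∀ i j, Had a b c d i j ≠ 0) (p q : Fin 4) :
    ((Had a b c d).submatrix p.succAbove q.succAbove).det ≠ 0 := by
  intro h
  have hadj : adjugate (Had a b c d) q p = 0 := by
    rw [adjugate_fin_succ_eq_det_submatrix, h, mul_zero]
  have hmul : (a + b + c + d) ^ 2 • adjugate (Had a b c d) =
      (Had a b c d).det • Had a b c d := by
    rw [← mul_one (adjugate _), ← Matrix.mul_smul, ← had_mul_self, ← mul_assoc, adjugate_mul,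
      Matrix.smul_mul, one_mul]
  have hqp := congrFun (congrFun hmul q) p
  rw [Matrix.smul_apply, Matrix.smul_apply, hadj, smul_zero, smul_eq_mul] at hqp
  exact mul_ne_zero ((det_had_ne_zero_iff a b c d).2 hs) (hentry q p) hqp.symm

theorem had_mul_apply_ne {F : Type*} [Field F] [CharP F 2] {a b c d : F}
    (hne : a ≠ b ∧ a ≠ c ∧ a ≠ d ∧ b ≠ c ∧ b ≠ d ∧ c ≠ d)
    (h₁ : a * d ≠ b * c) (h₂ : b * d ≠ a * c) (h₃ : c * d ≠ a * b)
    {i j k l : Fin 4} (hij : i ≠ j) (hkl : k ≠ l) :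
    Had a b c d i k * Had a b c d j l ≠ Had a b c d i l * Had a b c d j k := by
  have hsq : ∀ {x y : F}, x ≠ y → x * x ≠ y * y := fun hxy h =>
    hxy (CharTwo.sq_injective (by simpa [sq] using h))
  obtain ⟨hab, hac, had, hbc, hbd, hcd⟩ := hne
  have hab := hsq hab
  have hac := hsq hac
  have had := hsq had
  have hbc := hsq hbc
  have hbd := hsq hbd
  have hcd := hsq hcd
  fin_cases i <;> fin_cases j <;> first | exact absurd rfl hij | skip
  all_goals
    fin_cases k <;> fin_cases l <;> first | exact absurd rfl hkl | (simp [Had]; grind)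

/-- The `4 × 4` Hadamard matrix `Had(a,b,c,d)` over `𝔽_{2^r}` is MDS iff
`a, b, c, d` are nonzero and pairwise distinct, `ad ≠ bc`, `bd ≠ ac`,
`cd ≠ ab`, and `a + b + c + d ≠ 0`. -/
theorem hadamard_mds_iff (r : ℕ) (hr : 1 ≤ r) (a b c d : GaloisField 2 r) :
    IsMDS (Had a b c d) ↔
      (a ≠ 0 ∧ b ≠ 0 ∧ c ≠ 0 ∧ d ≠ 0) ∧
      (a ≠ b ∧ a ≠ c ∧ a ≠ d ∧ b ≠ c ∧ b ≠ d ∧ c ≠ d) ∧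
      a * d ≠ b * c ∧ b * d ≠ a * c ∧ c * d ≠ a * b ∧
      a + b + c + d ≠ 0 := by
  constructor
  · intro h
    refine ⟨⟨h.apply_ne_zero 0 0, h.apply_ne_zero 0 1, h.apply_ne_zero 0 2,
      h.apply_ne_zero 0 3⟩, ⟨?_, ?_, ?_, ?_, ?_, ?_⟩, ?_, ?_, ?_, ?_⟩
    · rintro rfl
      exact h.mul_apply_ne (i := 0) (j := 1) (k := 0) (l := 1) (by decide) (by decide) rfl
    · rintro rfl
      exact h.mul_apply_ne (i := 0) (j := 2) (k := 0) (l := 2) (by decide) (by decide) rfl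
    · rintro rfl
      exact h.mul_apply_ne (i := 0) (j := 3) (k := 0) (l := 3) (by decide) (by decide) rfl
    · rintro rfl
      exact h.mul_apply_ne (i := 0) (j := 3) (k := 1) (l := 2) (by decide) (by decide) rfl
    · rintro rfl
      exact h.mul_apply_ne (i := 0) (j := 2) (k := 1) (l := 3) (by decide) (by decide) rfl
    · rintro rfl
      exact h.mul_apply_ne (i := 0) (j := 1) (k := 2) (l := 3) (by decide) (by decide) rfl
    · have := h.mul_apply_ne (i := 0) (j := 2) (k := 0) (l := 1) (by decide) (by decide)
      simpa [Had] using this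
    · have := h.mul_apply_ne (i := 0) (j := 1) (k := 0) (l := 3) (by decide) (by decide)
      simp only [Had, of_apply, cons_val] at this
      grind
    · have := h.mul_apply_ne (i := 0) (j := 3) (k := 0) (l := 2) (by decide) (by decide)
      simp only [Had, of_apply, cons_val] at this
      grind
    · exact (det_had_ne_zero_iff a b c d).1
        (h 4 id id Function.injective_id Function.injective_id)
  · rintro ⟨⟨ha, hb, hc, hd⟩, hne, h₁, h₂, h₃, hs⟩ k row col hrow hcol
    have hentry : ∀ i j, Had a b c d i j ≠ 0 := by
      intro i j
      fin_cases i <;> fin_cases j <;> assumption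
    have hk : k ≤ 4 := by simpa using Fintype.card_le_of_injective row hrow
    interval_cases k
    · simp
    · simpa using hentry (row 0) (col 0)
    · rw [det_fin_two, sub_ne_zero]
      exact had_mul_apply_ne hne h₁ h₂ h₃ (hrow.ne (by decide)) (hcol.ne (by decide))
    · obtain ⟨p, σ, rfl⟩ := exists_eq_succAbove_comp_perm hrow
      obtain ⟨q, τ, rfl⟩ := exists_eq_succAbove_comp_perm hcol
      exact det_submatrix_perm_ne_zero
        (det_had_submatrix_succAbove_ne_zero hs hentry p q) σ τ
    · exact det_submatrix_perm_ne_zero ((det_had_ne_zero_iff a b c d).2 hs)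
        (Equiv.ofBijective row (Finite.injective_iff_bijective.1 hrow))
        (Equiv.ofBijective col (Finite.injective_iff_bijective.1 hcol))
end

section
/- Let r ≥ 3 and let 𝔽 = 𝔽_{2^r}. The number of tuples (a,b,c,d) ∈ 𝔽^4 such that the 4×4 Hadamard matrix Had(a,b,c,d) is MDS and involutory (equivalently, Had(a,b,c,d) is MDS and a + b + c + d = 1) equals (2^r−2)(2^r−4)(2^r−7). -/
open Matrix

section HadamardMDS

variable {F : Type*} [Field F]

theorem exists_succAbove_comp_equiv {n : ℕ} (f : Fin n → Fin (n + 1))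
    (hf : Function.Injective f) :
    ∃ (p : Fin (n + 1)) (σ : Fin n ≃ Fin n), f = p.succAbove ∘ σ := by
  obtain ⟨p, hp⟩ : ∃ p, ∀ i, f i ≠ p := by
    by_contra! h
    have := Fintype.card_le_of_surjective f h
    simp at this
  choose σ hσ using fun i => Fin.exists_succAbove_eq (hp i)
  have hinj : Function.Injective σ := fun i j hij => hf (by rw [← hσ i, ← hσ j, hij])
  exact ⟨p, Equiv.ofBijective σ (Finite.injective_iff_bijective.mp hinj),
    funext fun i => (hσ i).symm⟩

theorem det_submatrix_equiv_ne_zero {n : ℕ} (M : Matrix (Fin n) (Fin n) F)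
    (hM : M.det ≠ 0) (σ τ : Fin n ≃ Fin n) : (M.submatrix σ τ).det ≠ 0 := by
  rw [← isUnit_iff_ne_zero, ← Matrix.isUnit_iff_isUnit_det] at hM ⊢
  exact (Matrix.isUnit_submatrix_equiv σ τ).mpr hM

theorem det_ne_zero_of_mul_self_eq_one {n : ℕ} {M : Matrix (Fin n) (Fin n) F}
    (hM : M * M = 1) : M.det ≠ 0 := by
  intro h
  simpa [h] using congrArg Matrix.det hM

/-- The minors of corank one of an involutory matrix with nonzero entries do not vanish. -/
theorem det_submatrix_ne_zero_of_mul_self_eq_one {n : ℕ}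
    {M : Matrix (Fin (n + 1)) (Fin (n + 1)) F} (hM : M * M = 1) (h : ∀ i j, M i j ≠ 0)
    {row col : Fin n → Fin (n + 1)} (hr : Function.Injective row)
    (hc : Function.Injective col) : (M.submatrix row col).det ≠ 0 := by
  obtain ⟨p, σ, rfl⟩ := exists_succAbove_comp_equiv row hr
  obtain ⟨q, τ, rfl⟩ := exists_succAbove_comp_equiv col hc
  rw [← Matrix.submatrix_submatrix]
  apply det_submatrix_equiv_ne_zero
  intro h0
  have hadj : M.adjugate = M.det • M := by
    calc M.adjugate = M.adjugate * (M * M) := by rw [hM, mul_one]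
      _ = M.det • M := by rw [← mul_assoc, Matrix.adjugate_mul, smul_mul_assoc, one_mul]
  have hqp := congrFun₂ hadj q p
  rw [Matrix.adjugate_fin_succ_eq_det_submatrix, h0, mul_zero] at hqp
  exact mul_ne_zero (det_ne_zero_of_mul_self_eq_one hM) (h q p) hqp.symm

/-- A `4 × 4` involutory matrix is MDS as soon as its entries and its `2 × 2` minors
do not vanish. -/
theorem isMDS_iff_of_mul_self_eq_one {M : Matrix (Fin 4) (Fin 4) F} (hM : M * M = 1) :
    IsMDS M ↔ (∀ i j, M i j ≠ 0) ∧
      ∀ i j k l, i ≠ j → k ≠ l → M i k * M j l - M i l * M j k ≠ 0 := by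
  constructor
  · refine fun h => ⟨fun i j => ?_, fun i j k l hij hkl => ?_⟩
    · simpa using h 1 (fun _ => i) (fun _ => j) (Function.injective_of_subsingleton _)
        (Function.injective_of_subsingleton _)
    · have inj : ∀ {x y : Fin 4}, x ≠ y → Function.Injective ![x, y] := by
        intro x y hxy u v
        fin_cases u <;> fin_cases v <;> simp [hxy, hxy.symm]
      have := h 2 ![i, j] ![k, l] (inj hij) (inj hkl)
      rw [Matrix.det_fin_two] at this
      simpa using this
  · rintro ⟨h1, h2⟩ k row col hr hc
    have hk : k ≤ 4 := by simpa using Fintype.card_le_of_injective row hr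
    interval_cases k
    · simp
    · simpa using h1 _ _
    · rw [Matrix.det_fin_two]
      exact h2 _ _ _ _ (hr.ne (by decide)) (hc.ne (by decide))
    · exact det_submatrix_ne_zero_of_mul_self_eq_one hM h1 hr hc
    · exact det_submatrix_equiv_ne_zero M (det_ne_zero_of_mul_self_eq_one hM)
        (Equiv.ofBijective row (Finite.injective_iff_bijective.mp hr))
        (Equiv.ofBijective col (Finite.injective_iff_bijective.mp hc))

theorem card_compl_zero_one [Fintype F] [DecidableEq F] :
    ({0, 1} : Finset F)ᶜ.card = Fintype.card F - 2 := by
  rw [Finset.card_compl, Finset.card_pair zero_ne_one]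

variable [CharP F 2]

theorem had_mul_self_eq_one_iff (a b c d : F) :
    Had a b c d * Had a b c d = 1 ↔ a + b + c + d = 1 := by
  have h2 : (2 : F) = 0 := CharTwo.two_eq_zero
  constructor
  · intro h
    have h00 := congrFun₂ h 0 0
    simp [Had, Matrix.mul_apply, Fin.sum_univ_four] at h00
    have : (a + b + c + d - 1) ^ 2 = 0 := by
      linear_combination h00 +
        (a * b + a * c + a * d + b * c + b * d + c * d + 1 - a - b - c - d) * h2
    exact sub_eq_zero.mp (pow_eq_zero_iff two_ne_zero |>.mp this)
  · intro h
    ext i j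
    fin_cases i <;> fin_cases j <;> simp [Had, Matrix.mul_apply, Fin.sum_univ_four] <;> grind

theorem had_isMDS_iff {a b c d : F} (h : Had a b c d * Had a b c d = 1) :
    IsMDS (Had a b c d) ↔
      (a ≠ 0 ∧ b ≠ 0 ∧ c ≠ 0 ∧ d ≠ 0) ∧
      (a ≠ b ∧ a ≠ c ∧ a ≠ d ∧ b ≠ c ∧ b ≠ d ∧ c ≠ d) ∧
      a * b ≠ c * d ∧ a * c ≠ b * d ∧ a * d ≠ b * c := by
  rw [isMDS_iff_of_mul_self_eq_one h]
  have sq : ∀ {x y : F}, x ≠ y → x * x - y * y ≠ 0 := by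
    intro x y hxy h0
    rw [CharTwo.sub_eq_add, ← CharTwo.add_mul_self, mul_self_eq_zero, CharTwo.add_eq_zero] at h0
    exact hxy h0
  constructor
  · rintro ⟨h1, h2⟩
    have e := h1 0
    have m := fun j k l => h2 0 j k l
    refine ⟨⟨e 0, e 1, e 2, e 3⟩, ⟨?_, ?_, ?_, ?_, ?_, ?_⟩, ?_, ?_, ?_⟩ <;> intro h0
    · exact m 1 0 1 (by decide) (by decide) (by simp [Had, h0])
    · exact m 2 0 2 (by decide) (by decide) (by simp [Had, h0])
    · exact m 3 0 3 (by decide) (by decide) (by simp [Had, h0])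
    · exact m 3 1 2 (by decide) (by decide) (by simp [Had, h0])
    · exact m 2 1 3 (by decide) (by decide) (by simp [Had, h0])
    · exact m 1 2 3 (by decide) (by decide) (by simp [Had, h0])
    · exact m 2 0 3 (by decide) (by decide) (by simp [Had]; linear_combination h0)
    · exact m 1 0 3 (by decide) (by decide) (by simp [Had]; linear_combination h0)
    · exact m 1 0 2 (by decide) (by decide) (by simp [Had]; linear_combination h0)
  · rintro ⟨⟨ha, hb, hc, hd⟩, ⟨hab, hac, had, hbc, hbd, hcd⟩, p, q, s⟩
    replace hab := sq hab
    replace hac := sq hac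
    replace had := sq had
    replace hbc := sq hbc
    replace hbd := sq hbd
    replace hcd := sq hcd
    clear sq h
    constructor
    · intro i j
      fin_cases i <;> fin_cases j <;> simpa [Had]
    · intro i j k l hij hkl
      fin_cases i <;> fin_cases j <;> first | exact absurd rfl hij | skip
      all_goals fin_cases k <;> fin_cases l <;> first | exact absurd rfl hkl | skip
      all_goals
        clear hij hkl
        simp [Had]
        grind

variable [DecidableEq F]

/-- The values of `a` excluded by the MDS conditions on
`Had a (a + x) (a + y) (a + 1 + x + y)`. -/
def exceptionalValues (x y : F) : Finset F :=
  {0, x, y, 1 + x + y, y * (1 + x + y), x * (1 + x + y), x * y}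

/-- With `x = a + b` and `y = a + c`, the last entry of an involutory Hadamard matrix is
`a + 1 + x + y`, and the MDS conditions only exclude finitely many values of `x`, `y`, `a`. -/
theorem had_isMDS_involutory_iff (a b c d : F) :
    IsMDS (Had a b c d) ∧ Had a b c d * Had a b c d = 1 ↔
      ∃ x y, x ∉ ({0, 1} : Finset F) ∧ y ∉ ({0, 1, x, x + 1} : Finset F) ∧
        a ∉ exceptionalValues x y ∧ b = a + x ∧ c = a + y ∧ d = a + (1 + x + y) := by
  have h2 : (2 : F) = 0 := CharTwo.two_eq_zero
  rw [and_congr_left had_isMDS_iff, had_mul_self_eq_one_iff]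
  simp only [exceptionalValues, Finset.mem_insert, Finset.mem_singleton, not_or]
  constructor
  · rintro ⟨⟨⟨ha, hb, hc, hd⟩, ⟨hab, hac, had, hbc, hbd, hcd⟩, p, q, s⟩, h⟩
    obtain rfl : d = 1 + a + b + c := by linear_combination h - (a + b + c) * h2
    refine ⟨a + b, a + c, ⟨?_, ?_⟩, ⟨?_, ?_, ?_, ?_⟩, ⟨?_, ?_, ?_, ?_, ?_, ?_, ?_⟩, ?_, ?_, ?_⟩ <;>
      grind
  · rintro ⟨x, y, ⟨hx0, hx1⟩, ⟨hy0, hy1, hyx, hyx1⟩, ⟨ha, hax, hay, haz, hyz, hxz, hxy⟩,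
      rfl, rfl, rfl⟩
    refine ⟨⟨⟨?_, ?_, ?_, ?_⟩, ⟨?_, ?_, ?_, ?_, ?_, ?_⟩, ?_, ?_, ?_⟩, ?_⟩ <;> grind

variable [Fintype F]

theorem card_compl_exceptionalValues {x y : F} (hx : x ∉ ({0, 1} : Finset F))
    (hy : y ∉ ({0, 1, x, x + 1} : Finset F)) :
    (exceptionalValues x y)ᶜ.card = Fintype.card F - 7 := by
  have h2 : (2 : F) = 0 := CharTwo.two_eq_zero
  simp only [Finset.mem_insert, Finset.mem_singleton, not_or] at hx hy
  obtain ⟨hx0, hx1⟩ := hx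
  obtain ⟨hy0, hy1, hyx, hyx1⟩ := hy
  obtain ⟨z, hz⟩ : ∃ z, z = 1 + x + y := ⟨_, rfl⟩
  have hz0 : z ≠ 0 := by grind
  have hz1 : z ≠ 1 := by grind
  have hzx : z ≠ x := by grind
  have hzy : z ≠ y := by grind
  have hxyz : x ≠ y * z := by grind
  have hyxz : y ≠ x * z := by grind
  have hzxy : z ≠ x * y := by grind
  rw [exceptionalValues, ← hz, Finset.card_compl]
  congr 1
  repeat rw [Finset.card_insert_of_notMem]
  · simp
  all_goals
    simp only [Finset.mem_insert, Finset.mem_singleton, not_or]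
    grind

theorem card_compl_zero_one_add {x : F} (hx : x ∉ ({0, 1} : Finset F)) :
    ({0, 1, x, x + 1} : Finset F)ᶜ.card = Fintype.card F - 4 := by
  have h2 : (2 : F) = 0 := CharTwo.two_eq_zero
  simp only [Finset.mem_insert, Finset.mem_singleton, not_or] at hx
  rw [Finset.card_compl]
  congr 1
  repeat rw [Finset.card_insert_of_notMem]
  · simp
  all_goals
    simp only [Finset.mem_insert, Finset.mem_singleton, not_or]
    grind

theorem card_involutory_had_isMDS :
    Nat.card {t : F × F × F × F //
        IsMDS (Had t.1 t.2.1 t.2.2.1 t.2.2.2) ∧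
        Had t.1 t.2.1 t.2.2.1 t.2.2.2 * Had t.1 t.2.1 t.2.2.1 t.2.2.2 = 1} =
      (Fintype.card F - 2) * (Fintype.card F - 4) * (Fintype.card F - 7) := by
  let T : Finset (Σ _ : F, Σ _ : F, F) :=
    ({0, 1} : Finset F)ᶜ.sigma fun x =>
      ({0, 1, x, x + 1} : Finset F)ᶜ.sigma fun y => (exceptionalValues x y)ᶜ
  let g : (Σ _ : F, Σ _ : F, F) → F × F × F × F := fun p =>
    (p.2.2, p.2.2 + p.1, p.2.2 + p.2.1, p.2.2 + (1 + p.1 + p.2.1))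
  have hg : Function.Injective g := by
    rintro ⟨x, y, a⟩ ⟨x', y', a'⟩ h
    simp only [g, Prod.mk.injEq] at h
    obtain ⟨rfl, hx, hy, -⟩ := h
    rw [add_left_cancel hx, add_left_cancel hy]
  have hT : T.card = (Fintype.card F - 2) * (Fintype.card F - 4) * (Fintype.card F - 7) := by
    rw [Finset.card_sigma, ← card_compl_zero_one, mul_assoc]
    refine Finset.sum_const_nat fun x hx => ?_
    rw [Finset.mem_compl] at hx
    rw [Finset.card_sigma, ← card_compl_zero_one_add hx]
    refine Finset.sum_const_nat fun y hy => ?_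
    exact card_compl_exceptionalValues hx (Finset.mem_compl.mp hy)
  rw [← hT, ← Finset.card_image_of_injective T hg]
  refine Nat.subtype_card _ ?_
  rintro ⟨a, b, c, d⟩
  rw [had_isMDS_involutory_iff, Finset.mem_image]
  simp only [T, g, Finset.mem_sigma, Finset.mem_compl, Prod.mk.injEq]
  constructor
  · rintro ⟨⟨x, y, a⟩, ⟨hx, hy, ha⟩, rfl, rfl, rfl, rfl⟩
    exact ⟨x, y, hx, hy, ha, rfl, rfl, rfl⟩
  · rintro ⟨x, y, hx, hy, ha, rfl, rfl, rfl⟩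
    exact ⟨⟨x, y, a⟩, ⟨hx, hy, ha⟩, rfl, rfl, rfl, rfl⟩

end HadamardMDS

/-- The number of tuples `(a,b,c,d) ∈ 𝔽_{2^r}^4` (with `r ≥ 3`) whose `4 × 4`
Hadamard matrix is MDS and involutory equals `(2^r-2)(2^r-4)(2^r-7)`. -/
theorem count_involutory_hadamard_mds (r : ℕ) (hr : 3 ≤ r) :
    Nat.card {t : GaloisField 2 r × GaloisField 2 r × GaloisField 2 r × GaloisField 2 r //
        IsMDS (Had t.1 t.2.1 t.2.2.1 t.2.2.2) ∧
        Had t.1 t.2.1 t.2.2.1 t.2.2.2 * Had t.1 t.2.1 t.2.2.1 t.2.2.2 = 1} =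
      (2 ^ r - 2) * (2 ^ r - 4) * (2 ^ r - 7) := by
  classical
  have := Fintype.ofFinite (GaloisField 2 r)
  rw [card_involutory_had_isMDS, ← Nat.card_eq_fintype_card, GaloisField.card 2 r (by omega)]
end

section
/- Let r ≥ 1, 𝔽 = 𝔽_{2^r}, n ≥ 1, and let M be a 2n×2n matrix over 𝔽 written in block form M = fromBlocks A1 A2 A3 A4 with n×n blocks. If M is involutory and MDS, then: A3 is invertible, I + A1 is invertible, A2 = (I + A1²)·A3⁻¹, A4 = A3·A1·A3⁻¹, and M = D·H·D⁻¹, where H = fromBlocks A1 (I + A1) (I + A1) A1 and D = fromBlocks I 0 0 (A3·(I + A1)⁻¹) (which is invertible). -/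
open Matrix

namespace IsMDS

variable {F : Type*} [Field F] {n : ℕ} {A B C D : Matrix (Fin n) (Fin n) F}

theorem isUnit_toBlocks₁₂ (h : IsMDS (fromBlocks A B C D)) : IsUnit B :=
  (Matrix.isUnit_iff_isUnit_det B).2
    (h n Sum.inl Sum.inr Sum.inl_injective Sum.inr_injective).isUnit

theorem isUnit_toBlocks₂₁ (h : IsMDS (fromBlocks A B C D)) : IsUnit C :=
  (Matrix.isUnit_iff_isUnit_det C).2
    (h n Sum.inr Sum.inl Sum.inr_injective Sum.inl_injective).isUnit

end IsMDS

/-- Any `2n × 2n` involutory MDS matrix `M = fromBlocks A₁ A₂ A₃ A₄` over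
`𝔽_{2^r}` satisfies: `A₃` and `I + A₁` are invertible,
`A₂ = (I + A₁²)·A₃⁻¹`, `A₄ = A₃·A₁·A₃⁻¹`, and `M = D·H·D⁻¹` where
`H = fromBlocks A₁ (I + A₁) (I + A₁) A₁` and
`D = fromBlocks I 0 0 (A₃·(I + A₁)⁻¹)` is invertible. -/
theorem involutory_mds_block_form (r n : ℕ) (hr : 1 ≤ r) (hn : 1 ≤ n)
    (A1 A2 A3 A4 : Matrix (Fin n) (Fin n) (GaloisField 2 r))
    (hInv : fromBlocks A1 A2 A3 A4 * fromBlocks A1 A2 A3 A4 = 1)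
    (hMDS : IsMDS (fromBlocks A1 A2 A3 A4)) :
    IsUnit A3 ∧ IsUnit (1 + A1) ∧
    A2 = (1 + A1 ^ 2) * A3⁻¹ ∧
    A4 = A3 * A1 * A3⁻¹ ∧
    IsUnit (fromBlocks (1 : Matrix (Fin n) (Fin n) (GaloisField 2 r)) 0 0
      (A3 * (1 + A1)⁻¹)) ∧
    fromBlocks A1 A2 A3 A4 =
      fromBlocks 1 0 0 (A3 * (1 + A1)⁻¹) *
        fromBlocks A1 (1 + A1) (1 + A1) A1 *
        (fromBlocks 1 0 0 (A3 * (1 + A1)⁻¹))⁻¹ := by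
  have h2 := hMDS.isUnit_toBlocks₁₂
  have h3 := hMDS.isUnit_toBlocks₂₁
  have hd3 := (Matrix.isUnit_iff_isUnit_det A3).1 h3
  rw [fromBlocks_multiply, ← fromBlocks_one, fromBlocks_inj] at hInv
  obtain ⟨h11, -, h21, -⟩ := hInv
  have add_self (X : Matrix (Fin n) (Fin n) (GaloisField 2 r)) : X + X = 0 := by
    ext i j
    exact CharTwo.add_self_eq_zero _
  have hsq : (1 + A1) * (1 + A1) = 1 + A1 ^ 2 := by
    linear_combination (norm := noncomm_ring) add_self A1
  have h23 : A2 * A3 = 1 + A1 ^ 2 := by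
    linear_combination (norm := noncomm_ring) h11 - add_self (A1 * A1)
  have hU : IsUnit (1 + A1) := by
    rw [← isUnit_pow_iff two_ne_zero, sq, hsq, ← h23]
    exact h2.mul h3
  have hdU := (Matrix.isUnit_iff_isUnit_det (1 + A1)).1 hU
  have hA2 : A2 = (1 + A1 ^ 2) * A3⁻¹ := by
    rw [← h23, mul_nonsing_inv_cancel_right _ _ hd3]
  have h43 : A4 * A3 = A3 * A1 := by
    linear_combination (norm := noncomm_ring) h21 - add_self (A3 * A1)
  have hA4 : A4 = A3 * A1 * A3⁻¹ := by
    rw [← h43, mul_nonsing_inv_cancel_right _ _ hd3]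
  have hD : IsUnit (fromBlocks (1 : Matrix (Fin n) (Fin n) (GaloisField 2 r)) 0 0
      (A3 * (1 + A1)⁻¹)) :=
    isUnit_fromBlocks_zero₁₂.2 ⟨isUnit_one, h3.mul (isUnit_nonsing_inv_iff.2 hU)⟩
  refine ⟨h3, hU, hA2, hA4, hD, ?_⟩
  have hcomm : A1 * (1 + A1)⁻¹ = (1 + A1)⁻¹ * A1 := by
    have hc : Commute A1 (1 + A1) := Commute.add_right (.one_right A1) (.refl A1)
    obtain ⟨u, hu⟩ := hU
    rw [← hu] at hc ⊢
    rw [← coe_units_inv]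
    exact hc.units_inv_right
  have hconj : fromBlocks A1 A2 A3 A4 * fromBlocks 1 0 0 (A3 * (1 + A1)⁻¹) =
      fromBlocks 1 0 0 (A3 * (1 + A1)⁻¹) * fromBlocks A1 (1 + A1) (1 + A1) A1 := by
    simp only [fromBlocks_multiply, mul_one, mul_zero, zero_mul, one_mul, add_zero, zero_add]
    rw [fromBlocks_inj]
    refine ⟨rfl, ?_, ?_, ?_⟩
    · rw [← mul_assoc, h23, ← hsq, mul_nonsing_inv_cancel_right _ _ hdU]
    · rw [nonsing_inv_mul_cancel_right _ _ hdU]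
    · rw [← mul_assoc, h43, mul_assoc, hcomm, mul_assoc]
  rw [← hconj, mul_nonsing_inv_cancel_right _ _ ((Matrix.isUnit_iff_isUnit_det _).1 hD)]
end

section
/- Let r ≥ 1 and let 𝔽 = 𝔽_{2^r}. The number of 2×2 MDS matrices over 𝔽 equals (2^r−1)³(2^r−2). -/
open Matrix

theorem isMDS_fin_two_iff {F : Type*} [Field F] (M : Matrix (Fin 2) (Fin 2) F) :
    IsMDS M ↔ (∀ i j, M i j ≠ 0) ∧ M.det ≠ 0 := by
  constructor
  · intro h
    refine ⟨fun i j => ?_, ?_⟩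
    · simpa using h 1 (fun _ => i) (fun _ => j) (Function.injective_of_subsingleton _)
        (Function.injective_of_subsingleton _)
    · simpa using h 2 id id Function.injective_id Function.injective_id
  · rintro ⟨hentry, hdet⟩ k row col hrow hcol
    have hk : k ≤ 2 := by simpa using Fintype.card_le_of_injective row hrow
    interval_cases k
    · simp
    · simpa using hentry (row 0) (col 0)
    · let e := Equiv.ofBijective row (Finite.injective_iff_bijective.mp hrow)
      let f := Equiv.ofBijective col (Finite.injective_iff_bijective.mp hcol)
      have hunit : IsUnit (M.submatrix e f) :=
        (isUnit_submatrix_equiv (A := M) e f).2 ((isUnit_iff_isUnit_det M).2 hdet.isUnit)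
      exact ((isUnit_iff_isUnit_det _).1 hunit).ne_zero

/-- A `2 × 2` MDS matrix `!![a, b; c, d]` is determined by the nonzero entries `a`, `b`, `c` and
the ratio `a * d / (b * c)`, which may be any unit other than `1`. -/
def mdsFinTwoEquiv (F : Type*) [Field F] :
    {M : Matrix (Fin 2) (Fin 2) F // IsMDS M} ≃ (Fˣ × Fˣ × Fˣ) × {x : Fˣ // x ≠ 1} where
  toFun M :=
    have h := (isMDS_fin_two_iff M.1).1 M.2
    let a := Units.mk0 _ (h.1 0 0)
    let b := Units.mk0 _ (h.1 0 1)
    let c := Units.mk0 _ (h.1 1 0)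
    let d := Units.mk0 _ (h.1 1 1)
    ((a, b, c), ⟨a * d / (b * c), fun hx => h.2 <| by
      rw [det_fin_two, sub_eq_zero]
      exact congrArg Units.val (div_eq_one.1 hx)⟩)
  invFun p :=
    ⟨!![(p.1.1 : F), p.1.2.1; p.1.2.2, ↑(p.2.1 * (p.1.2.1 * p.1.2.2) / p.1.1)], by
      obtain ⟨⟨a, b, c⟩, x, hx⟩ := p
      refine (isMDS_fin_two_iff _).2 ⟨fun i j => ?_, fun h => hx ?_⟩
      · fin_cases i <;> fin_cases j <;> simp
      · rw [det_fin_two_of, sub_eq_zero, ← Units.val_mul, ← Units.val_mul, Units.val_inj,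
          mul_div_cancel] at h
        exact mul_eq_right.1 h⟩
  left_inv M := by
    have h := (isMDS_fin_two_iff M.1).1 M.2
    have := h.1 0 0
    have := h.1 0 1
    have := h.1 1 0
    ext i j
    fin_cases i <;> fin_cases j <;> simp [field]
  right_inv p := by
    obtain ⟨⟨a, b, c⟩, x, hx⟩ := p
    ext <;> simp [field]

theorem card_two_by_two_mds (F : Type*) [Field F] [Finite F] :
    Nat.card {M : Matrix (Fin 2) (Fin 2) F // IsMDS M} =
      (Nat.card F - 1) ^ 3 * (Nat.card F - 2) := by
  classical
  have := Fintype.ofFinite F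
  have hne : Nat.card {x : Fˣ // x ≠ 1} = Nat.card Fˣ - 1 := by
    simp [Nat.card_eq_fintype_card, Fintype.card_subtype_compl]
  rw [Nat.card_congr (mdsFinTwoEquiv F), Nat.card_prod, Nat.card_prod, Nat.card_prod, hne,
    Nat.card_units, Nat.sub_sub]
  ring

/-- The number of `2 × 2` MDS matrices over `𝔽_{2^r}` equals `(2^r-1)³(2^r-2)`. -/
theorem count_two_by_two_mds (r : ℕ) (hr : 1 ≤ r) :
    Nat.card {M : Matrix (Fin 2) (Fin 2) (GaloisField 2 r) // IsMDS M} =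
      (2 ^ r - 1) ^ 3 * (2 ^ r - 2) := by
  rw [card_two_by_two_mds, GaloisField.card 2 r (by omega)]
end

section
/- Let r ≥ 1 and let 𝔽 = 𝔽_{2^r}. The number of 2×2 matrices over 𝔽 that are both involutory and MDS equals (2^r−1)(2^r−2). -/
open Matrix

/-- In characteristic two, the first row `(a, b)` of a `2 × 2` matrix determines the matrix if it
is involutory and MDS; the rows that occur are those with `b ≠ 0` and `a ∉ {0, 1}`. -/
theorem involutory_isMDS_fin_two_iff {F : Type*} [Field F] [CharP F 2]
    (M : Matrix (Fin 2) (Fin 2) F) :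
    M * M = 1 ∧ IsMDS M ↔
      M 0 1 ≠ 0 ∧ (M 0 0 ≠ 0 ∧ M 0 0 ≠ 1) ∧ M 1 1 = M 0 0 ∧
        M 1 0 = (1 + M 0 0 ^ 2) / M 0 1 := by
  have h2 : (2 : F) = 0 := CharTwo.two_eq_zero
  have hmul : M * M = 1 ↔
      (M 0 0 * M 0 0 + M 0 1 * M 1 0 = 1 ∧ M 0 0 * M 0 1 + M 0 1 * M 1 1 = 0) ∧
        M 1 0 * M 0 0 + M 1 1 * M 1 0 = 0 ∧ M 1 0 * M 0 1 + M 1 1 * M 1 1 = 1 := by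
    simp [← Matrix.ext_iff, Fin.forall_fin_two, mul_apply, Fin.sum_univ_two]
  simp only [isMDS_fin_two_iff, hmul, Fin.forall_fin_two, det_fin_two]
  generalize M 0 0 = a
  generalize M 0 1 = b
  generalize M 1 0 = c
  generalize M 1 1 = d
  constructor
  · rintro ⟨⟨⟨h00, h01⟩, -, -⟩, ⟨⟨ha, hb⟩, hc, -⟩, -⟩
    have hda : d = a := by
      apply mul_left_cancel₀ hb
      linear_combination h01 - a * b * h2
    refine ⟨hb, ⟨ha, ?_⟩, hda, ?_⟩
    · rintro rfl
      exact mul_ne_zero hb hc (by linear_combination h00)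
    · rw [eq_div_iff hb]
      linear_combination h00 - a ^ 2 * h2
  · rintro ⟨hb, ⟨ha, ha1⟩, rfl, hc⟩
    rw [eq_div_iff hb] at hc
    have hc0 : c ≠ 0 := by
      rintro rfl
      have hsq : (d - 1) ^ 2 = 0 := by linear_combination -hc - d * h2
      exact ha1 (sub_eq_zero.mp (pow_eq_zero_iff two_ne_zero |>.mp hsq))
    refine ⟨⟨⟨?_, ?_⟩, ?_, ?_⟩, ⟨⟨ha, hb⟩, hc0, ha⟩, ?_⟩
    · linear_combination hc + d ^ 2 * h2
    · linear_combination d * b * h2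
    · linear_combination c * d * h2
    · linear_combination hc + d ^ 2 * h2
    · intro h
      exact one_ne_zero (α := F) (by linear_combination -h - hc)

/-- An involutory MDS matrix of size two in characteristic two is given by its first row. -/
def involutoryMDSEquiv (F : Type*) [Field F] [CharP F 2] :
    {M : Matrix (Fin 2) (Fin 2) F // M * M = 1 ∧ IsMDS M} ≃
      {b : F // b ≠ 0} × {a : F // a ≠ 0 ∧ a ≠ 1} where
  toFun M :=
    (⟨M.1 0 1, ((involutory_isMDS_fin_two_iff M.1).mp M.2).1⟩,
      ⟨M.1 0 0, ((involutory_isMDS_fin_two_iff M.1).mp M.2).2.1⟩)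
  invFun x :=
    ⟨!![x.2.1, x.1.1; (1 + x.2.1 ^ 2) / x.1.1, x.2.1],
      (involutory_isMDS_fin_two_iff _).mpr ⟨x.1.2, x.2.2, rfl, rfl⟩⟩
  left_inv M := by
    obtain ⟨-, -, h11, h10⟩ := (involutory_isMDS_fin_two_iff M.1).mp M.2
    apply Subtype.ext
    ext i j
    fin_cases i <;> fin_cases j <;> simp [h11, h10]
  right_inv _ := rfl

theorem card_ne_zero_subtype (F : Type*) [Field F] [Finite F] :
    Nat.card {b : F // b ≠ 0} = Nat.card F - 1 := by
  rw [← Nat.card_units F]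
  exact Nat.card_congr unitsEquivNeZero.symm

theorem card_ne_zero_ne_one_subtype (F : Type*) [Field F] [Finite F] :
    Nat.card {a : F // a ≠ 0 ∧ a ≠ 1} = Nat.card F - 2 := by
  have h : {a : F | a ≠ 0 ∧ a ≠ 1} = {0, 1}ᶜ := by
    ext a
    simp
  rw [← Set.coe_ofPred, Nat.card_coe_set_eq, h, Set.ncard_compl, Set.ncard_pair zero_ne_one]

/-- The number of `2 × 2` involutory MDS matrices over `𝔽_{2^r}` equals
`(2^r-1)(2^r-2)`. -/
theorem count_two_by_two_involutory_mds (r : ℕ) (hr : 1 ≤ r) :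
    Nat.card {M : Matrix (Fin 2) (Fin 2) (GaloisField 2 r) //
        M * M = 1 ∧ IsMDS M} =
      (2 ^ r - 1) * (2 ^ r - 2) := by
  rw [Nat.card_congr (involutoryMDSEquiv (GaloisField 2 r)), Nat.card_prod, card_ne_zero_subtype,
    card_ne_zero_ne_one_subtype, GaloisField.card 2 r (by lia)]
end

section
/- Let r ≥ 1, 𝔽 = 𝔽_{2^r}, m ≥ 1, let G = (Fin m → ZMod 2), let a : G → 𝔽, and let M be the Hadamard matrix of order n = 2^m over 𝔽 given by M i j = a(i + j). Let c = ∑_{v ∈ G} a(v) (the sum of the first row). Then the adjugate of M satisfies adjugate(M) = c^(n−2) • M; in particular, every (n−1)×(n−1) minor of M is of the form α·c^(n−2) for some α ∈ 𝔽. -/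
open Matrix

/-- The square of the matrix `a (i + j)` is scalar, for an index group of exponent two and
entries in characteristic two. -/
theorem Matrix.of_add_mul_self_of_charTwo {R G : Type*} [CommRing R] [CharP R 2]
    [AddCommGroup G] [Fintype G] [DecidableEq G] (hG : ∀ g : G, g + g = 0) (a : G → R) :
    (of fun i j => a (i + j) : Matrix G G R) * of (fun i j => a (i + j)) =
      (∑ v, a v) ^ 2 • (1 : Matrix G G R) := by
  ext i j
  simp only [mul_apply, of_apply, smul_apply, smul_eq_mul]
  rcases eq_or_ne i j with rfl | hij
  · rw [one_apply_eq, mul_one, CharTwo.sum_sq,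
      ← Equiv.sum_comp (Equiv.addLeft i) fun k => a (i + k) * a (k + i)]
    refine Finset.sum_congr rfl fun k _ => ?_
    have h : i + (i + k) = k := by rw [← add_assoc, hG, zero_add]
    rw [Equiv.coe_addLeft, add_comm (i + k) i, h, sq]
  · rw [one_apply_ne hij, mul_zero]
    refine Finset.sum_involution (fun k _ => k + (i + j)) ?_ ?_ ?_ ?_
    · intro k _
      have h₁ : i + (k + (i + j)) = k + j := by
        rw [show i + (k + (i + j)) = (i + i) + (k + j) by abel, hG, zero_add]
      have h₂ : k + (i + j) + j = i + k := by
        rw [show k + (i + j) + j = (j + j) + (i + k) by abel, hG, zero_add]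
      rw [h₁, h₂, mul_comm (a (k + j)), CharTwo.add_self_eq_zero]
    · intro k _ _ h
      refine hij ?_
      have h' : i + j = 0 := by simpa using h
      rw [eq_neg_of_add_eq_zero_left h', neg_eq_of_add_eq_zero_left (hG j)]
    · simp
    · intro k _
      rw [add_assoc, hG, add_zero]

theorem Matrix.adjugate_of_add_of_sum_ne_zero {R G : Type*} [CommRing R] [IsDomain R] [CharP R 2]
    [AddCommGroup G] [Fintype G] [DecidableEq G] (hG : ∀ g : G, g + g = 0)
    (hcard : 2 ≤ Fintype.card G) (a : G → R) (hc : ∑ v, a v ≠ 0) :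
    (of fun i j => a (i + j) : Matrix G G R).adjugate =
      (∑ v, a v) ^ (Fintype.card G - 2) • of (fun i j => a (i + j)) := by
  have hsq := of_add_mul_self_of_charTwo hG a
  set M : Matrix G G R := of fun i j => a (i + j)
  set c := ∑ v, a v
  have hdet : M.det = c ^ Fintype.card G := by
    have h := congrArg det hsq
    rw [det_mul, det_smul, det_one, mul_one, ← sq, ← pow_mul, mul_comm 2, pow_mul] at h
    exact CharTwo.sq_injective h
  have h : c ^ 2 • M.adjugate = c ^ 2 • (c ^ (Fintype.card G - 2) • M) := by
    rw [smul_smul, ← pow_add, Nat.add_sub_cancel' hcard, ← hdet]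
    calc c ^ 2 • M.adjugate = M.adjugate * (M * M) := by rw [hsq, Matrix.mul_smul, Matrix.mul_one]
      _ = M.det • M := by rw [← Matrix.mul_assoc, adjugate_mul, Matrix.smul_mul, Matrix.one_mul]
  exact smul_right_injective _ (pow_ne_zero 2 hc) h

theorem Matrix.adjugate_of_add_of_charTwo {R G : Type*} [CommRing R] [IsDomain R] [CharP R 2]
    [AddCommGroup G] [Fintype G] [DecidableEq G] (hG : ∀ g : G, g + g = 0)
    (hcard : 2 ≤ Fintype.card G) (a : G → R) :
    (of fun i j => a (i + j) : Matrix G G R).adjugate =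
      (∑ v, a v) ^ (Fintype.card G - 2) • of (fun i j => a (i + j)) := by
  let b : G → Polynomial R := fun g => Polynomial.C (a g) + (Pi.single 0 Polynomial.X : G → Polynomial R) g
  have hsum : ∑ v, b v = Polynomial.X + Polynomial.C (∑ v, a v) := by
    simp [b, Finset.sum_add_distrib, add_comm]
  have hb : ∀ g, Polynomial.evalRingHom 0 (b g) = a g := by
    intro g
    rcases eq_or_ne g 0 with rfl | hg
    · simp [b]
    · simp [b, hg]
  have h := adjugate_of_add_of_sum_ne_zero hG hcard b
    (hsum ▸ Polynomial.X_add_C_ne_zero _)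
  have hM : (Polynomial.evalRingHom (0 : R)).mapMatrix (of fun i j => b (i + j)) =
      (of fun i j => a (i + j) : Matrix G G R) := by
    ext i j
    exact hb _
  rw [← hM, ← RingHom.map_adjugate, h]
  ext i j
  have hs : Polynomial.evalRingHom 0 (∑ v, b v) = ∑ v, a v := by
    rw [map_sum, Finset.sum_congr rfl fun v _ => hb v]
  rw [RingHom.mapMatrix_apply, map_apply, smul_apply, smul_eq_mul, map_mul, map_pow, hs]
  rfl

/-- A scalar dividing the adjugate divides every minor of corank one. -/
theorem Matrix.exists_det_submatrix_eq_mul_of_adjugate_eq_smul {R n : Type*} [CommRing R]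
    [Fintype n] [DecidableEq n] {k : ℕ} (hk : Fintype.card n = k + 1) {M N : Matrix n n R} {d : R}
    (hM : M.adjugate = d • N) {row col : Fin k → n} (hrow : row.Injective)
    (hcol : col.Injective) : ∃ α : R, (M.submatrix row col).det = α * d := by
  have extend : ∀ f : Fin k → n, f.Injective → ∃ e : Fin (k + 1) ≃ n, ∀ i, e i.succ = f i := by
    intro f hf
    obtain ⟨x, hx⟩ : ∃ x, x ∉ Set.range f := by
      by_contra! h
      have := Fintype.card_le_of_surjective f h
      simp [hk] at this
    exact ⟨Equiv.ofBijective (Fin.cons x f) ((Fintype.bijective_iff_injective_and_card _).2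
      ⟨Fin.cons_injective_iff.2 ⟨hx, hf⟩, by simp [hk]⟩), fun i => by simp⟩
  obtain ⟨e, he⟩ := extend row hrow
  obtain ⟨f, hf⟩ := extend col hcol
  have hminor : (M.submatrix row col).det = (M.submatrix e f).adjugate 0 0 := by
    rw [adjugate_fin_succ_eq_det_submatrix]
    simp only [Fin.succAbove_zero, Fin.val_zero, add_zero, pow_zero, one_mul, submatrix_submatrix]
    congr 2 <;> ext i <;> simp [he, hf]
  have hprod : M.submatrix e f = (1 : Matrix n n R).submatrix e f * M.submatrix f f := by
    rw [submatrix_mul_equiv, Matrix.one_mul]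
  refine ⟨(N.submatrix f f * ((1 : Matrix n n R).submatrix e f).adjugate) 0 0, ?_⟩
  rw [hminor, hprod, adjugate_mul_distrib, adjugate_submatrix_equiv_self, hM, submatrix_smul,
    Pi.smul_apply, Pi.smul_apply, Matrix.smul_mul, smul_apply, smul_eq_mul, mul_comm]

/-- For the Hadamard matrix `M` of order `n = 2^m` over `𝔽_{2^r}` with entries
`M i j = a (i + j)` and `c = ∑ v, a v` the sum of the first row, the adjugate
satisfies `adjugate M = c^(n-2) • M`; in particular every `(n-1) × (n-1)`
minor of `M` equals `α · c^(n-2)` for some `α`. -/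
theorem hadamard_adjugate (r m : ℕ) (hr : 1 ≤ r) (hm : 1 ≤ m)
    (a : (Fin m → ZMod 2) → GaloisField 2 r) :
    (Matrix.of fun i j => a (i + j) :
        Matrix (Fin m → ZMod 2) (Fin m → ZMod 2) (GaloisField 2 r)).adjugate =
      (∑ v, a v) ^ (2 ^ m - 2) • Matrix.of (fun i j => a (i + j)) ∧
    ∀ (row col : Fin (2 ^ m - 1) → (Fin m → ZMod 2)),
      Function.Injective row → Function.Injective col →
      ∃ α : GaloisField 2 r,
        ((Matrix.of fun i j => a (i + j) :
            Matrix (Fin m → ZMod 2) (Fin m → ZMod 2) (GaloisField 2 r)).submatrix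
          row col).det = α * (∑ v, a v) ^ (2 ^ m - 2) := by
  have hcard : Fintype.card (Fin m → ZMod 2) = 2 ^ m := by simp
  have htwo : 2 ≤ 2 ^ m := Nat.le_self_pow (by omega) 2
  have hadj := adjugate_of_add_of_charTwo (fun g => by ext i; exact CharTwo.add_self_eq_zero (g i))
    (hcard ▸ htwo) a
  rw [hcard] at hadj
  exact ⟨hadj, fun row col hrow hcol =>
    exists_det_submatrix_eq_mul_of_adjugate_eq_smul (by omega) hadj hrow hcol⟩
end

section
/- Let r ≥ 1, 𝔽 = 𝔽_{2^r}, and let a1, a2, a3 ∈ 𝔽 be nonzero with a1 + a2 + a3 ≠ 0. Then the 4×4 Hadamard matrix Had(0, a1, a2, a3) is an NMDS matrix over 𝔽. -/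
open Matrix

/-- A square matrix of order `n` is Near-MDS if it is not MDS and, for every
`1 ≤ g ≤ n - 1`, every `g × (g+1)` and `(g+1) × g` submatrix contains a
nonsingular `g × g` submatrix. -/
def IsNMDS {F : Type*} [Field F] {ι : Type*} [Fintype ι] (M : Matrix ι ι F) : Prop :=
  ¬ IsMDS M ∧
  ∀ g : ℕ, 1 ≤ g → g ≤ Fintype.card ι - 1 →
    (∀ (row : Fin g → ι) (col : Fin (g + 1) → ι),
        Function.Injective row → Function.Injective col →
        ∃ s : Fin g → Fin (g + 1), Function.Injective s ∧
          (M.submatrix row (col ∘ s)).det ≠ 0) ∧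
    (∀ (row : Fin (g + 1) → ι) (col : Fin g → ι),
        Function.Injective row → Function.Injective col →
        ∃ s : Fin g → Fin (g + 1), Function.Injective s ∧
          (M.submatrix (row ∘ s) col).det ≠ 0)

/-- Dropping a row from a nonsingular matrix leaves a nonsingular maximal minor. -/
theorem exists_minor_ne_zero_of_det_ne_zero {F : Type*} [Field F] {n : ℕ}
    {M : Matrix (Fin (n + 1)) (Fin (n + 1)) F} (hM : M.det ≠ 0)
    {row : Fin n → Fin (n + 1)} {col : Fin (n + 1) → Fin (n + 1)}
    (hrow : Function.Injective row) (hcol : Function.Injective col) :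
    ∃ s : Fin n → Fin (n + 1), Function.Injective s ∧
      (M.submatrix row (col ∘ s)).det ≠ 0 := by
  by_contra! h
  obtain ⟨k, hk⟩ : ∃ k, k ∉ Set.range row := by
    by_contra! hs
    simpa using Fintype.card_le_of_surjective row hs
  have hrow' : Function.Injective (Fin.cons k row : Fin (n + 1) → Fin (n + 1)) :=
    Fin.cons_injective_iff.2 ⟨hk, hrow⟩
  let e := Equiv.ofBijective _ (Finite.injective_iff_bijective.1 hrow')
  let f := Equiv.ofBijective _ (Finite.injective_iff_bijective.1 hcol)
  have hunit : IsUnit (M.submatrix e f) :=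
    (isUnit_submatrix_equiv e f).2 ((isUnit_iff_isUnit_det M).2 hM.isUnit)
  refine ((isUnit_iff_isUnit_det _).1 hunit).ne_zero ?_
  rw [det_succ_row_zero]
  refine Finset.sum_eq_zero fun j _ => ?_
  have hj : ((M.submatrix e f).submatrix Fin.succ j.succAbove).det = 0 :=
    h j.succAbove Fin.succAbove_right_injective
  rw [hj, mul_zero]

/-- For a matrix with zero diagonal and nonzero off-diagonal entries, a `2 × 2` submatrix which
meets the diagonal in its first column is nonsingular. -/
theorem det_submatrix_two_ne_zero {F ι : Type*} [Field F] {M : Matrix ι ι F}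
    (hdiag : ∀ i, M i i = 0) (hoff : ∀ i j, i ≠ j → M i j ≠ 0)
    {row col : Fin 2 → ι} (hrow : Function.Injective row) (hcol : Function.Injective col)
    (hmeet : col 0 = row 0 ∨ col 0 = row 1) : (M.submatrix row col).det ≠ 0 := by
  have hr : row 0 ≠ row 1 := hrow.ne (by decide)
  have hc : col 0 ≠ col 1 := hcol.ne (by decide)
  rw [det_fin_two]
  simp only [submatrix_apply]
  rcases hmeet with h | h
  · rw [h] at hc ⊢
    rw [hdiag, zero_mul, zero_sub]
    exact neg_ne_zero.2 (mul_ne_zero (hoff _ _ hc) (hoff _ _ hr.symm))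
  · rw [h] at hc ⊢
    rw [hdiag, mul_zero, sub_zero]
    exact mul_ne_zero (hoff _ _ hr) (hoff _ _ hc)

/-- A nonsingular `4 × 4` matrix with zero diagonal and nonzero off-diagonal entries has a
nonsingular maximal minor in each of its `g × (g + 1)` submatrices, `1 ≤ g ≤ 3`. -/
theorem exists_minor_ne_zero_of_diag_eq_zero {F : Type*} [Field F]
    {M : Matrix (Fin 4) (Fin 4) F} (hdiag : ∀ i, M i i = 0) (hoff : ∀ i j, i ≠ j → M i j ≠ 0)
    (hdet : M.det ≠ 0) {g : ℕ} (hg : 1 ≤ g) (hg' : g ≤ 3)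
    {row : Fin g → Fin 4} {col : Fin (g + 1) → Fin 4}
    (hrow : Function.Injective row) (hcol : Function.Injective col) :
    ∃ s : Fin g → Fin (g + 1), Function.Injective s ∧
      (M.submatrix row (col ∘ s)).det ≠ 0 := by
  interval_cases g
  · obtain ⟨k, hk⟩ : ∃ k, row 0 ≠ col k := by
      by_contra! h
      exact absurd (hcol ((h 0).symm.trans (h 1))) (by decide)
    refine ⟨fun _ => k, Function.injective_of_subsingleton _, ?_⟩
    rw [det_fin_one]
    exact hoff _ _ hk
  · obtain ⟨k, hk⟩ : ∃ k, col k = row 0 ∨ col k = row 1 := by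
      have hr : row 0 ≠ row 1 := hrow.ne (by decide)
      have h01 : col 0 ≠ col 1 := hcol.ne (by decide)
      have h02 : col 0 ≠ col 2 := hcol.ne (by decide)
      have h12 : col 1 ≠ col 2 := hcol.ne (by decide)
      by_contra! h
      have h0 := h 0
      have h1 := h 1
      have h2 := h 2
      omega
    have hs : Function.Injective ![k, k + 1] := by
      clear hk
      decide +revert
    exact ⟨![k, k + 1], hs, det_submatrix_two_ne_zero hdiag hoff hrow (hcol.comp hs) hk⟩
  · exact exists_minor_ne_zero_of_det_ne_zero hdet hrow hcol

/-- A nonsingular symmetric `4 × 4` matrix with zero diagonal and nonzero off-diagonal entries is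
Near-MDS. -/
theorem isNMDS_of_diag_eq_zero {F : Type*} [Field F] {M : Matrix (Fin 4) (Fin 4) F}
    (hsymm : Mᵀ = M) (hdiag : ∀ i, M i i = 0) (hoff : ∀ i j, i ≠ j → M i j ≠ 0)
    (hdet : M.det ≠ 0) : IsNMDS M := by
  refine ⟨fun h => ?_, fun g hg hg' => ⟨fun row col hrow hcol => ?_, fun row col hrow hcol => ?_⟩⟩
  · refine h 1 (fun _ => 0) (fun _ => 0) (Function.injective_of_subsingleton _)
      (Function.injective_of_subsingleton _) ?_
    rw [det_fin_one]
    exact hdiag 0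
  · exact exists_minor_ne_zero_of_diag_eq_zero hdiag hoff hdet hg hg' hrow hcol
  · obtain ⟨s, hs, h⟩ := exists_minor_ne_zero_of_diag_eq_zero hdiag hoff hdet hg hg' hcol hrow
    refine ⟨s, hs, ?_⟩
    rwa [← det_transpose, transpose_submatrix, hsymm]

theorem Had_transpose {F : Type*} (a b c d : F) : (Had a b c d)ᵀ = Had a b c d := by
  ext i j
  fin_cases i <;> fin_cases j <;> rfl

theorem Had_det {F : Type*} [Field F] [CharP F 2] (a b c d : F) :
    (Had a b c d).det = (a + b + c + d) ^ 4 := by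
  have hfactor : (Had a b c d).det =
      (a + b + c + d) * (a + b - c - d) * (a - b + c - d) * (a - b - c + d) := by
    simp [Had, det_succ_row_zero, Fin.sum_univ_succ, Fin.succAbove]
    ring
  rw [hfactor]
  simp only [CharTwo.sub_eq_add]
  ring

/-- For nonzero `a₁, a₂, a₃ ∈ 𝔽_{2^r}` with `a₁ + a₂ + a₃ ≠ 0`, the `4 × 4`
Hadamard matrix `Had(0, a₁, a₂, a₃)` is NMDS. -/
theorem hadamard_zero_nmds (r : ℕ) (hr : 1 ≤ r) (a1 a2 a3 : GaloisField 2 r)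
    (h1 : a1 ≠ 0) (h2 : a2 ≠ 0) (h3 : a3 ≠ 0) (hsum : a1 + a2 + a3 ≠ 0) :
    IsNMDS (Had 0 a1 a2 a3) := by
  exact isNMDS_of_diag_eq_zero (Had_transpose 0 a1 a2 a3)
    (fun i => by fin_cases i <;> rfl)
    (fun i j hij => by
      fin_cases i <;> fin_cases j <;> first | exact absurd rfl hij | assumption)
    (by rw [Had_det, zero_add]; exact pow_ne_zero 4 hsum)
end

section
/- Let r ≥ 1, 𝔽 = 𝔽_{2^r}, and let a1, a2, a3 ∈ 𝔽 be nonzero. Then the 4×4 circulant matrix Circ(0, a1, a2, a3) is an NMDS matrix over 𝔽. -/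
open Matrix

/-- The `4 × 4` circulant matrix with first row `a, b, c, d`. -/
def Circ {F : Type*} (a b c d : F) : Matrix (Fin 4) (Fin 4) F :=
  !![a, b, c, d; d, a, b, c; c, d, a, b; b, c, d, a]

/-- An injection `Fin 3 → Fin 4` omits one index and permutes the others. -/
theorem exists_eq_succAbove_comp_perm_s15 (row : Fin 3 → Fin 4) (hrow : Function.Injective row) :
    ∃ (i : Fin 4) (e : Equiv.Perm (Fin 3)), row = i.succAbove ∘ e := by
  obtain ⟨i, hi⟩ : ∃ i, ∀ x, row x ≠ i := by
    by_contra! h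
    simpa using Fintype.card_le_of_surjective row h
  choose f hf using fun x => Fin.exists_succAbove_eq (hi x)
  have hinj : Function.Injective f := fun x y h => hrow (by rw [← hf x, ← hf y, h])
  exact ⟨i, Equiv.ofBijective f (Finite.injective_iff_bijective.mp hinj),
    funext fun x => (hf x).symm⟩

theorem Circ_transpose {F : Type*} (a b c d : F) : (Circ a b c d)ᵀ = Circ a d c b := by
  ext i j
  fin_cases i <;> fin_cases j <;> rfl

section

variable {F : Type*} [Field F] {a b c : F}

theorem Circ_zero_apply_self (i : Fin 4) : Circ 0 a b c i i = 0 := by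
  fin_cases i <;> rfl

theorem Circ_zero_apply_ne (ha : a ≠ 0) (hb : b ≠ 0) (hc : c ≠ 0) {i j : Fin 4} (hij : i ≠ j) :
    Circ 0 a b c i j ≠ 0 := by
  fin_cases i <;> fin_cases j <;> first | exact absurd rfl hij | assumption

/-- In characteristic two, the minor of `Circ 0 a b c` omitting row `i` and column `i + 2`
is `b ^ 3`. -/
theorem det_Circ_zero_submatrix_succAbove [CharP F 2] (i : Fin 4) :
    ((Circ 0 a b c).submatrix i.succAbove (i + 2).succAbove).det = b ^ 3 := by
  have h2 : (2 : F) = 0 := CharTwo.two_eq_zero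
  fin_cases i <;> simp [Circ, Matrix.det_fin_three, Fin.succAbove, Fin.lt_def] <;> grind

theorem Circ_zero_exists_columns [CharP F 2] (ha : a ≠ 0) (hb : b ≠ 0) (hc : c ≠ 0)
    {g : ℕ} (hg : 1 ≤ g) (hg' : g ≤ 3) (row : Fin g → Fin 4) (col : Fin (g + 1) → Fin 4)
    (hrow : Function.Injective row) (hcol : Function.Injective col) :
    ∃ s : Fin g → Fin (g + 1), Function.Injective s ∧
      ((Circ 0 a b c).submatrix row (col ∘ s)).det ≠ 0 := by
  interval_cases g
  · obtain ⟨p, hp⟩ : ∃ p, row 0 ≠ col p := by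
      by_contra! h
      exact absurd (hcol ((h 0).symm.trans (h 1))) (by decide)
    refine ⟨fun _ => p, Function.injective_of_subsingleton _, ?_⟩
    simpa using Circ_zero_apply_ne ha hb hc hp
  · have hij : row 0 ≠ row 1 := hrow.ne (by decide)
    obtain ⟨p, hp⟩ : ∃ p, col p = row 0 ∨ col p = row 1 := by
      by_contra! h
      have h01 := hcol.ne (show (0 : Fin 3) ≠ 1 by decide)
      have h02 := hcol.ne (show (0 : Fin 3) ≠ 2 by decide)
      have h12 := hcol.ne (show (1 : Fin 3) ≠ 2 by decide)
      have h0 := h 0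
      have h1 := h 1
      have h2 := h 2
      omega
    obtain ⟨q, hq⟩ := exists_ne p
    have hpq := hcol.ne hq
    refine ⟨![p, q], by simpa [Function.Injective, Fin.forall_fin_two, eq_comm] using hq, ?_⟩
    rcases hp with hp | hp <;> rw [hp] at hpq <;>
      simp [Matrix.det_fin_two, hp, Circ_zero_apply_self,
        Circ_zero_apply_ne ha hb hc hij, Circ_zero_apply_ne ha hb hc hij.symm,
        Circ_zero_apply_ne ha hb hc hpq.symm]
  · obtain ⟨i, e, rfl⟩ := exists_eq_succAbove_comp_perm_s15 row hrow
    let f := Equiv.ofBijective col (Finite.injective_iff_bijective.mp hcol)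
    refine ⟨f.symm ∘ (i + 2).succAbove, f.symm.injective.comp Fin.succAbove_right_injective, ?_⟩
    have hf : col ∘ f.symm ∘ (i + 2).succAbove = (i + 2).succAbove :=
      funext fun x => f.apply_symm_apply _
    have hdet := Matrix.det_permute e
      ((Circ 0 a b c).submatrix i.succAbove (i + 2).succAbove)
    rw [Matrix.submatrix_submatrix, Function.comp_id] at hdet
    rw [hf, hdet, det_Circ_zero_submatrix_succAbove]
    rcases Int.units_eq_one_or (Equiv.Perm.sign e) with h | h <;> simp [h, hb]

end

/-- For nonzero `a₁, a₂, a₃ ∈ 𝔽_{2^r}`, the `4 × 4` circulant matrix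
`Circ(0, a₁, a₂, a₃)` is NMDS. -/
theorem circulant_zero_nmds (r : ℕ) (hr : 1 ≤ r) (a1 a2 a3 : GaloisField 2 r)
    (h1 : a1 ≠ 0) (h2 : a2 ≠ 0) (h3 : a3 ≠ 0) :
    IsNMDS (Circ 0 a1 a2 a3) := by
  refine ⟨fun h => h 1 (fun _ => 0) (fun _ => 0) (Function.injective_of_subsingleton _)
    (Function.injective_of_subsingleton _) (by simp [Circ_zero_apply_self]), fun g hg hg' => ?_⟩
  rw [Fintype.card_fin] at hg'
  refine ⟨Circ_zero_exists_columns h1 h2 h3 hg hg', fun row col hrow hcol => ?_⟩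
  obtain ⟨s, hs, hdet⟩ := Circ_zero_exists_columns h3 h2 h1 hg hg' col row hcol hrow
  refine ⟨s, hs, ?_⟩
  rwa [← Circ_transpose, ← Matrix.transpose_submatrix, Matrix.det_transpose] at hdet
end

section
/- Let r ≥ 1, 𝔽 = 𝔽_{2^r}, and for a, a1, a2 ∈ 𝔽 let T(a, a1, a2) denote the 4×4 Type-I circulant-like matrix !![a,1,1,1; 1,1,a1,a2; 1,a2,1,a1; 1,a1,a2,1] over 𝔽. Then T(a, a1, a2) is orthogonal (i.e., T·Tᵀ = I) if and only if (a, a1, a2) = (0, 0, 1) or (a, a1, a2) = (0, 1, 0); moreover, both of these two matrices are NMDS. In particular, there exist exactly two orthogonal Type-I circulant-like NMDS matrices of order 4 over 𝔽. -/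
open Matrix

/-- The `4 × 4` Type-I circulant-like matrix with parameters `a, a₁, a₂`:
first row/column entries `1` except the `(0,0)` entry `a`, and lower-right
`3 × 3` block the circulant `Circ(1, a₁, a₂)`. -/
def TypeI {F : Type*} [One F] (a a1 a2 : F) : Matrix (Fin 4) (Fin 4) F :=
  !![a, 1, 1, 1; 1, 1, a1, a2; 1, a2, 1, a1; 1, a1, a2, 1]

theorem IsNMDS.map {F K ι : Type*} [Field F] [Field K] [Fintype ι] {M : Matrix ι ι F}
    (hM : IsNMDS M) (f : F →+* K) : IsNMDS (M.map f) := by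
  have det_ne {n : ℕ} (row col : Fin n → ι) :
      ((M.map f).submatrix row col).det ≠ 0 ↔ (M.submatrix row col).det ≠ 0 := by
    rw [submatrix_map, ← RingHom.mapMatrix_apply, ← RingHom.map_det, map_ne_zero]
  simpa only [IsNMDS, IsMDS, det_ne] using hM

theorem TypeI_transpose {F : Type*} [One F] (a a1 a2 : F) :
    (TypeI a a1 a2)ᵀ = TypeI a a2 a1 := by
  ext i j
  fin_cases i <;> fin_cases j <;> simp [TypeI]

theorem TypeI_map {F K : Type*} [Semiring F] [Semiring K] (f : F →+* K) (a a1 a2 : F) :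
    (TypeI a a1 a2).map f = TypeI (f a) (f a1) (f a2) := by
  ext i j
  fin_cases i <;> fin_cases j <;> simp [TypeI]

theorem exists_det_submatrix_succAbove_ne_zero {R ι κ : Type*} [CommRing R] {g : ℕ}
    (M : Matrix ι κ R) (i : ι) (row : Fin g → ι) (col : Fin (g + 1) → κ)
    (h : (M.submatrix (Fin.cons i row : Fin (g + 1) → ι) col).det ≠ 0) :
    ∃ j : Fin (g + 1), (M.submatrix row (col ∘ j.succAbove)).det ≠ 0 := by
  contrapose! h
  rw [det_succ_row_zero]
  exact Finset.sum_eq_zero fun j _ ↦ by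
    rw [submatrix_submatrix]
    exact mul_eq_zero_of_right _ (h j)

theorem det_TypeI_zmod_two (b : ZMod 2) : (TypeI 0 b (b + 1)).det = 1 := by
  fin_cases b <;> simp [TypeI, det_succ_row_zero, Fin.sum_univ_succ] <;> decide

theorem TypeI_zmod_two_exists_det_ne_zero (b : ZMod 2) {g : ℕ} (hg : g ≤ 3)
    (row : Fin g → Fin 4) (col : Fin (g + 1) → Fin 4)
    (hrow : row.Injective) (hcol : col.Injective) :
    ∃ j : Fin (g + 1),
      ((TypeI 0 b (b + 1)).submatrix row (col ∘ j.succAbove)).det ≠ 0 := by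
  interval_cases g
  · exact ⟨0, by simp⟩
  · simp only [det_fin_one, submatrix_apply, Function.comp_apply]
    revert b row col
    decide +kernel
  · simp only [det_fin_two, submatrix_apply, Function.comp_apply]
    revert b row col
    decide +kernel
  · obtain ⟨i, hi⟩ : ∃ i, i ∉ Set.range row := by
      by_contra! h
      simpa using Fintype.card_le_of_surjective row h
    have hcons : (Fin.cons i row : Fin 4 → Fin 4).Injective :=
      Fin.cons_injective_iff.mpr ⟨hi, hrow⟩
    refine exists_det_submatrix_succAbove_ne_zero _ i row col ?_
    rw [← isUnit_iff_ne_zero, ← isUnit_iff_isUnit_det]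
    change IsUnit ((TypeI 0 b (b + 1)).submatrix
      (Equiv.ofBijective _ (Finite.injective_iff_bijective.mp hcons))
      (Equiv.ofBijective _ (Finite.injective_iff_bijective.mp hcol)))
    rw [isUnit_submatrix_equiv, isUnit_iff_isUnit_det, det_TypeI_zmod_two]
    exact isUnit_one

theorem isNMDS_TypeI_zmod_two (b : ZMod 2) : IsNMDS (TypeI 0 b (b + 1)) := by
  refine ⟨fun h ↦ h 1 ![0] ![0] (Function.injective_of_subsingleton _)
    (Function.injective_of_subsingleton _) (by rw [det_fin_one]; simp [TypeI]), fun g _ hg ↦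
    ⟨fun row col hrow hcol ↦ ?_, fun row col hrow hcol ↦ ?_⟩⟩
  · obtain ⟨j, hj⟩ := TypeI_zmod_two_exists_det_ne_zero b hg row col hrow hcol
    exact ⟨j.succAbove, Fin.succAbove_right_injective, hj⟩
  · obtain ⟨j, hj⟩ := TypeI_zmod_two_exists_det_ne_zero (b + 1) hg col row hcol hrow
    refine ⟨j.succAbove, Fin.succAbove_right_injective, ?_⟩
    rwa [add_assoc, CharTwo.add_self_eq_zero, add_zero, ← TypeI_transpose,
      ← transpose_submatrix, det_transpose] at hj

theorem TypeI_mul_transpose_eq_one_iff {F : Type*} [Field F] [CharP F 2] (a a1 a2 : F) :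
    TypeI a a1 a2 * (TypeI a a1 a2)ᵀ = 1 ↔
      (a, a1, a2) = (0, 0, 1) ∨ (a, a1, a2) = (0, 1, 0) := by
  have h2 : (2 : F) = 0 := CharTwo.two_eq_zero
  simp only [Prod.mk.injEq]
  constructor
  · intro h
    have h00 := congrFun₂ h 0 0
    have h01 := congrFun₂ h 0 1
    have h12 := congrFun₂ h 1 2
    simp [TypeI, mul_apply, Fin.sum_univ_four] at h00 h01 h12
    have ha : a = 0 := by
      have : a * a = 0 := by linear_combination h00 - h2
      simpa using this
    have hsum : a1 + a2 = 1 := by linear_combination h01 - ha - h2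
    have hmul : a1 * a2 = 0 := by linear_combination h12 - hsum - h2
    rcases mul_eq_zero.mp hmul with h | h
    · exact .inl ⟨ha, h, by simpa [h] using hsum⟩
    · exact .inr ⟨ha, by simpa [h] using hsum, h⟩
  · rintro (⟨rfl, rfl, rfl⟩ | ⟨rfl, rfl, rfl⟩) <;> ext i j <;>
      fin_cases i <;> fin_cases j <;>
        simp [TypeI, mul_apply, Fin.sum_univ_four, CharTwo.add_self_eq_zero]

/-- A `4 × 4` Type-I circulant-like matrix over `𝔽_{2^r}` is orthogonal iff
its parameters are `(0,0,1)` or `(0,1,0)`; both resulting matrices are NMDS.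
Hence there exist exactly two orthogonal Type-I circulant-like NMDS matrices
of order `4` over `𝔽_{2^r}`. -/
theorem typeI_orthogonal_iff_and_nmds (r : ℕ) (hr : 1 ≤ r) :
    (∀ a a1 a2 : GaloisField 2 r,
        TypeI a a1 a2 * (TypeI a a1 a2)ᵀ = 1 ↔
          (a, a1, a2) = ((0 : GaloisField 2 r), (0 : GaloisField 2 r),
            (1 : GaloisField 2 r)) ∨
          (a, a1, a2) = ((0 : GaloisField 2 r), (1 : GaloisField 2 r),
            (0 : GaloisField 2 r))) ∧
    IsNMDS (TypeI (0 : GaloisField 2 r) 0 1) ∧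
    IsNMDS (TypeI (0 : GaloisField 2 r) 1 0) := by
  have hmap (b : ZMod 2) := (isNMDS_TypeI_zmod_two b).map (algebraMap (ZMod 2) (GaloisField 2 r))
  simp only [TypeI_map, map_add, map_zero, map_one] at hmap
  have : CharP (GaloisField 2 r) 2 := inferInstance
  refine ⟨TypeI_mul_transpose_eq_one_iff, ?_, ?_⟩
  · simpa using hmap 0
  · simpa [CharTwo.add_self_eq_zero] using hmap 1
end
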